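/- Let 2 ≤ r < s be integers, and let X, Y ⊆ [0,1] be ×r- and ×s-invariant sets with dim_H X > 0 and dim_H Y > 0. For all 0 < γ₄ < dim_H(X × Y) < γ₅, there exist c₁, c₂ > 0 such that for all sufficiently large N ∈ ℕ, the sets X_N × Y_{N'} and X_N × Y_{N'+1} are (c₁ r^{−N}, γ₅)_{c₂}-sets satisfying r^{Nγ₄} ≤ |X_N × Y_{N'}| ≤ r^{Nγ₅} and r^{Nγ₄} ≤ |X_N × Y_{N'+1}| ≤ r^{Nγ₅}. -/

import Mathlib

/-- `X ⊆ [0,1]` is `×r`-invariant: closed and `T_r X ⊆ X` where `T_r x = r x (mod 1)`. -/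
def TimesInvariant (r : ℕ) (X : Set ℝ) : Prop :=
  X ⊆ Set.Icc 0 1 ∧ IsClosed X ∧ ∀ x ∈ X, Int.fract ((r : ℝ) * x) ∈ X

/-- The `n`-th discrete approximation of `X`: the set `X` rounded down to the lattice
`r^{-n} ℤ`, i.e. `i/r^n ∈ X_n` iff `X ∩ [i/r^n, (i+1)/r^n) ≠ ∅` (for `0 ≤ i < r^n`). -/
def approx (r : ℕ) (X : Set ℝ) (n : ℕ) : Set ℝ :=
  {t | ∃ i : ℕ, i < r ^ n ∧ t = (i : ℝ) / (r : ℝ) ^ n ∧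
    (X ∩ Set.Ico ((i : ℝ) / (r : ℝ) ^ n) (((i : ℝ) + 1) / (r : ℝ) ^ n)).Nonempty}

/-- `n' = ⌊n log r / log s⌋`. -/
noncomputable def nprime (r s n : ℕ) : ℕ :=
  (⌊(n : ℝ) * Real.log r / Real.log s⌋).toNat

/-- `A` is a `(ρ,γ)_c`-set: `ρ`-separated, and any open ball of diameter `δ ≥ ρ`
contains at most `c (δ/ρ)^γ` of its points. -/
def IsRGCSet {α : Type*} [PseudoMetricSpace α] (ρ γ c : ℝ) (A : Set α) : Prop :=
  (∀ x ∈ A, ∀ y ∈ A, x ≠ y → ρ ≤ dist x y) ∧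
  ∀ δ : ℝ, ρ ≤ δ → ∀ x : α,
    ((A ∩ Metric.ball x (δ / 2)).ncard : ℝ) ≤ c * (δ / ρ) ^ γ

/-- The cartesian product of two subsets of `ℝ` as a subset of the Euclidean plane. -/
def prodSet (A B : Set ℝ) : Set (EuclideanSpace ℝ (Fin 2)) :=
  {p | p 0 ∈ A ∧ p 1 ∈ B}

open Classical in
noncomputable def dig (r : ℕ) (X : Set ℝ) (n : ℕ) : Finset ℕ :=
  (Finset.range (r ^ n)).filter (fun i => ∃ x ∈ X, x < 1 ∧ ⌊x * (r : ℝ) ^ n⌋₊ = i)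

theorem mem_dig {r : ℕ} (hr : 2 ≤ r) {X : Set ℝ} {n i : ℕ} :
    i ∈ dig r X n ↔ ∃ x ∈ X, x < 1 ∧ ⌊x * (r : ℝ) ^ n⌋₊ = i := by
  classical
  unfold dig
  rw [Finset.mem_filter, Finset.mem_range]
  refine ⟨fun h => h.2, fun h => ⟨?_, h⟩⟩
  obtain ⟨x, hx, h1, rfl⟩ := h
  have hp : (0 : ℝ) < (r : ℝ) ^ n := by positivity
  rw [Nat.floor_lt' (by positivity)]
  push_cast
  nlinarith

theorem approx_eq {r : ℕ} (hr : 2 ≤ r) {X : Set ℝ} (hX : TimesInvariant r X) (n : ℕ) :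
    approx r X n = (fun i : ℕ => (i : ℝ) / (r : ℝ) ^ n) '' (dig r X n : Set ℕ) := by
  have hp : (0 : ℝ) < (r : ℝ) ^ n := by positivity
  ext t
  simp only [approx, Set.mem_ofPred_eq, Set.mem_image, Finset.mem_coe, mem_dig hr]
  constructor
  · rintro ⟨i, hi, rfl, x, hx, h1, h2⟩
    refine ⟨i, ⟨x, hx, ?_, ?_⟩, rfl⟩
    · refine lt_of_lt_of_le h2 ?_
      rw [div_le_one hp]
      exact_mod_cast hi
    · rw [div_le_iff₀ hp] at h1
      rw [lt_div_iff₀ hp] at h2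
      rw [Nat.floor_eq_iff (le_trans (by positivity) h1)]
      exact ⟨h1, h2⟩
  · rintro ⟨i, ⟨x, hx, h1, rfl⟩, rfl⟩
    have h0 := (hX.1 hx).1
    refine ⟨_, ?_, rfl, x, hx, ?_, ?_⟩
    · rw [Nat.floor_lt' (by positivity)]
      push_cast
      nlinarith
    · rw [div_le_iff₀ hp]; exact Nat.floor_le (by positivity)
    · rw [lt_div_iff₀ hp]; exact Nat.lt_floor_add_one _

theorem iter_mem {r : ℕ} {X : Set ℝ} (hX : TimesInvariant r X) {x : ℝ} (hx : x ∈ X)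
    (hx1 : x < 1) (n : ℕ) : Int.fract (x * (r : ℝ) ^ n) ∈ X := by
  induction n with
  | zero =>
    have : Int.fract x = x := Int.fract_eq_self.2 ⟨(hX.1 hx).1, hx1⟩
    simpa [this] using hx
  | succ n ih =>
    have h := hX.2.2 _ ih
    convert h using 1
    rw [Int.fract_eq_fract]
    refine ⟨r * ⌊x * (r : ℝ) ^ n⌋, ?_⟩
    have := Int.self_sub_floor (x * (r : ℝ) ^ n)
    rw [← this]
    push_cast
    ring

theorem floor_div_pow {r : ℕ} (hr : 2 ≤ r) (x : ℝ) (n m : ℕ) :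
    ⌊x * (r : ℝ) ^ (n + m)⌋₊ / r ^ m = ⌊x * (r : ℝ) ^ n⌋₊ := by
  rw [← Nat.floor_div_natCast]
  congr 1
  have hp : (0 : ℝ) < (r : ℝ) ^ m := by positivity
  push_cast
  rw [pow_add, ← mul_assoc, mul_div_assoc, div_self hp.ne', mul_one]

theorem floor_mod_pow {r : ℕ} (hr : 2 ≤ r) {x : ℝ} (hx : 0 ≤ x) (n m : ℕ) :
    ⌊x * (r : ℝ) ^ (n + m)⌋₊ % r ^ m = ⌊Int.fract (x * (r : ℝ) ^ n) * (r : ℝ) ^ m⌋₊ := by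
  have h1 := floor_div_pow hr x n m
  have h2 := Nat.div_add_mod ⌊x * (r : ℝ) ^ (n + m)⌋₊ (r ^ m)
  rw [h1] at h2
  have h0 : 0 ≤ x * (r : ℝ) ^ n := by positivity
  have h3 : Int.fract (x * (r : ℝ) ^ n) * (r : ℝ) ^ m
      = x * (r : ℝ) ^ (n + m) - ((r ^ m * ⌊x * (r : ℝ) ^ n⌋₊ : ℕ) : ℝ) := by
    rw [← Int.self_sub_floor, ← natCast_floor_eq_intCast_floor h0]
    push_cast
    ring
  rw [h3, Nat.floor_sub_natCast]
  exact (Nat.sub_eq_of_eq_add' h2.symm).symm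

theorem dig_div {r : ℕ} (hr : 2 ≤ r) {X : Set ℝ} {n m i : ℕ}
    (hi : i ∈ dig r X (n + m)) : i / r ^ m ∈ dig r X n := by
  rw [mem_dig hr] at hi ⊢
  obtain ⟨x, hx, h1, rfl⟩ := hi
  exact ⟨x, hx, h1, (floor_div_pow hr x n m).symm⟩

theorem dig_mod {r : ℕ} (hr : 2 ≤ r) {X : Set ℝ} (hX : TimesInvariant r X) {n m i : ℕ}
    (hi : i ∈ dig r X (n + m)) : i % r ^ m ∈ dig r X m := by
  rw [mem_dig hr] at hi ⊢
  obtain ⟨x, hx, h1, rfl⟩ := hi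
  exact ⟨_, iter_mem hX hx h1 n, Int.fract_lt_one _, (floor_mod_pow hr (hX.1 hx).1 n m).symm⟩

theorem dig_card_le_pow (r : ℕ) (X : Set ℝ) (n : ℕ) : (dig r X n).card ≤ r ^ n := by
  classical
  unfold dig
  exact (Finset.card_filter_le _ _).trans (by simp)

theorem dig_card_mono {r : ℕ} (hr : 2 ≤ r) {X : Set ℝ} {n m : ℕ} (h : n ≤ m) :
    (dig r X n).card ≤ (dig r X m).card := by
  classical
  obtain ⟨k, rfl⟩ := Nat.exists_eq_add_of_le h
  have : dig r X n ⊆ (dig r X (n + k)).image (fun i => i / r ^ k) := by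
    intro i hi
    rw [mem_dig hr] at hi
    obtain ⟨x, hx, h1, rfl⟩ := hi
    rw [Finset.mem_image]
    exact ⟨_, (mem_dig hr).2 ⟨x, hx, h1, rfl⟩, floor_div_pow hr x n k⟩
  exact (Finset.card_le_card this).trans Finset.card_image_le

/-- digits whose prefix is a given word -/
theorem card_prefix {r : ℕ} (hr : 2 ≤ r) {X : Set ℝ} (hX : TimesInvariant r X) (n m u : ℕ) :
    ((dig r X (n + m)).filter (fun i => i / r ^ m = u)).card ≤ (dig r X m).card := by
  apply Finset.card_le_card_of_injOn (fun i => i % r ^ m)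
  · intro i hi
    simp only [Finset.coe_filter, Set.mem_ofPred_eq] at hi
    exact dig_mod hr hX hi.1
  · intro i hi j hj hij
    simp only [Finset.coe_filter, Set.mem_ofPred_eq] at hi hj
    rw [← Nat.div_add_mod i (r ^ m), ← Nat.div_add_mod j (r ^ m), hi.2, hj.2]
    simp only at hij
    rw [hij]

theorem dig_card_add {r : ℕ} (hr : 2 ≤ r) {X : Set ℝ} (hX : TimesInvariant r X) (n m : ℕ) :
    (dig r X (n + m)).card ≤ r ^ n * (dig r X m).card := by
  classical
  have h := Finset.card_le_mul_card_image_of_maps_to (s := dig r X (n + m)) (t := dig r X n)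
    (f := fun i => i / r ^ m) (fun i hi => dig_div hr hi) (dig r X m).card
    (fun u _ => card_prefix hr hX n m u)
  calc _ ≤ _ := h
    _ ≤ (dig r X m).card * r ^ n := Nat.mul_le_mul_left _ (dig_card_le_pow r X n)
    _ = _ := mul_comm _ _

/-- digits whose prefix is near a given one -/
noncomputable def near (r : ℕ) (X : Set ℝ) (k n : ℕ) (u : ℤ) : Finset ℕ :=
  (dig r X k).filter (fun i => |((i / r ^ (k - n) : ℕ) : ℤ) - u| ≤ 1)

theorem card_near {r : ℕ} (hr : 2 ≤ r) {X : Set ℝ} (hX : TimesInvariant r X) {k n : ℕ}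
    (hnk : n ≤ k) (u : ℤ) : (near r X k n u).card ≤ 3 * (dig r X (k - n)).card := by
  classical
  have hk : n + (k - n) = k := by omega
  have hsub : near r X k n u ⊆
      (Finset.Icc (u - 1) (u + 1)).biUnion (fun v =>
        (dig r X (n + (k - n))).filter (fun i => i / r ^ (k - n) = v.toNat)) := by
    intro i hi
    simp only [near, Finset.mem_filter] at hi
    rw [Finset.mem_biUnion]
    refine ⟨((i / r ^ (k - n) : ℕ) : ℤ), ?_, ?_⟩
    · rw [abs_le] at hi
      rw [Finset.mem_Icc]
      omega
    · rw [Finset.mem_filter, hk]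
      exact ⟨hi.1, by rw [Int.toNat_natCast]⟩
  refine (Finset.card_le_card hsub).trans (Finset.card_biUnion_le.trans ?_)
  refine (Finset.sum_le_sum (fun v _ => card_prefix hr hX n (k - n) v.toNat)).trans ?_
  simp only [Finset.sum_const, smul_eq_mul, Int.card_Icc]
  gcongr
  omega

theorem floor_near {a b : ℝ} (ha : 0 ≤ a) (h : |a - b| ≤ 1) : |((⌊a⌋₊ : ℕ) : ℤ) - ⌊b⌋| ≤ 1 := by
  rw [Int.natCast_floor_eq_floor ha]
  rw [abs_le] at h ⊢
  have h1 : ⌊a⌋ ≤ ⌊b⌋ + 1 := by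
    rw [← Int.floor_add_one]; exact Int.floor_le_floor (by linarith)
  have h2 : ⌊b⌋ ≤ ⌊a⌋ + 1 := by
    rw [← Int.floor_add_one]; exact Int.floor_le_floor (by linarith)
  omega

theorem mem_near {r : ℕ} (hr : 2 ≤ r) {X : Set ℝ} (hX : TimesInvariant r X) {k n : ℕ}
    (hnk : n ≤ k) {x p : ℝ} (hx : x ∈ X) (hx1 : x < 1) (h : |x - p| * (r : ℝ) ^ n ≤ 1) :
    ⌊x * (r : ℝ) ^ k⌋₊ ∈ near r X k n ⌊p * (r : ℝ) ^ n⌋ := by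
  have hk : n + (k - n) = k := by omega
  rw [near, Finset.mem_filter]
  refine ⟨(mem_dig hr).2 ⟨x, hx, hx1, rfl⟩, ?_⟩
  have := floor_div_pow hr x n (k - n)
  rw [hk] at this
  rw [this]
  have h0 := (hX.1 hx).1
  apply floor_near (by positivity)
  rw [← sub_mul, abs_mul, abs_of_pos (show (0 : ℝ) < (r : ℝ) ^ n by positivity)]
  exact h

theorem mem_near' {r : ℕ} (hr : 2 ≤ r) {X : Set ℝ} {k n i : ℕ}
    (hnk : n ≤ k) {p : ℝ} (hi : i ∈ dig r X k)
    (h : |(i : ℝ) / (r : ℝ) ^ k - p| * (r : ℝ) ^ n ≤ 1) :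
    i ∈ near r X k n ⌊p * (r : ℝ) ^ n⌋ := by
  have hk : n + (k - n) = k := by omega
  have hp : (0 : ℝ) < (r : ℝ) ^ k := by positivity
  rw [near, Finset.mem_filter]
  refine ⟨hi, ?_⟩
  have := floor_div_pow hr ((i : ℝ) / (r : ℝ) ^ k) n (k - n)
  rw [hk, div_mul_cancel₀ _ hp.ne', Nat.floor_natCast] at this
  rw [this]
  apply floor_near (by positivity)
  rw [← sub_mul, abs_mul, abs_of_pos (show (0 : ℝ) < (r : ℝ) ^ n by positivity)]
  exact h

theorem nprime_eq {r s : ℕ} (hr : 2 ≤ r) (hrs : r < s) (n : ℕ) :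
    nprime r s n = Nat.log s (r ^ n) := by
  have hs : (1 : ℝ) < s := by exact_mod_cast (show 1 < s by omega)
  have : (n : ℝ) * Real.log r / Real.log s = Real.logb s ((r ^ n : ℕ) : ℝ) := by
    rw [Real.logb]; push_cast; rw [Real.log_pow]
  rw [nprime, this]
  have h := Real.floor_logb_natCast (b := s) (r := ((r ^ n : ℕ) : ℝ)) (Nat.cast_nonneg _)
  rw [h, Int.log_natCast]
  simp

theorem nprime_le {r s : ℕ} (hr : 2 ≤ r) (hrs : r < s) (n : ℕ) :
    s ^ nprime r s n ≤ r ^ n := by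
  rw [nprime_eq hr hrs]
  exact Nat.pow_log_le_self s (by positivity)

theorem lt_nprime {r s : ℕ} (hr : 2 ≤ r) (hrs : r < s) (n : ℕ) :
    r ^ n < s ^ (nprime r s n + 1) := by
  rw [nprime_eq hr hrs]
  exact Nat.lt_pow_succ_log_self (by omega) _

theorem nprime_mono {r s : ℕ} (hr : 2 ≤ r) (hrs : r < s) {n m : ℕ} (h : n ≤ m) :
    nprime r s n ≤ nprime r s m := by
  rw [nprime_eq hr hrs, nprime_eq hr hrs]
  exact Nat.log_mono_right (Nat.pow_le_pow_right (by omega) h)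

theorem nprime_le_self {r s : ℕ} (hr : 2 ≤ r) (hrs : r < s) (n : ℕ) : nprime r s n ≤ n := by
  have h1 := nprime_le hr hrs n
  have h2 : r ^ n ≤ s ^ n := Nat.pow_le_pow_left hrs.le n
  exact (Nat.pow_le_pow_iff_right (by omega : 1 < s)).1 (h1.trans h2)

theorem nprime_sub {r s : ℕ} (hr : 2 ≤ r) (hrs : r < s) {n k : ℕ} (h : n ≤ k) :
    nprime r s k - nprime r s n ≤ nprime r s (k - n) + 1 := by
  have h1 := nprime_le hr hrs k
  have h2 := lt_nprime hr hrs n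
  have h3 := lt_nprime hr hrs (k - n)
  have h4 : r ^ k = r ^ n * r ^ (k - n) := by rw [← pow_add]; congr 1; omega
  have h5 : s ^ nprime r s k < s ^ (nprime r s n + 1 + (nprime r s (k - n) + 1)) := by
    rw [pow_add]
    calc _ ≤ _ := h1
      _ = _ := h4
      _ < _ := Nat.mul_lt_mul'' h2 h3
  have := (Nat.pow_lt_pow_iff_right (by omega : 1 < s)).1 h5
  omega

noncomputable def FF (r s : ℕ) (X Y : Set ℝ) (k : ℕ) : ℕ :=
  (dig r X k).card * (dig s Y (nprime r s k)).card

theorem FF_shift {r s : ℕ} (hr : 2 ≤ r) (hrs : r < s) {X Y : Set ℝ}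
    (hY : TimesInvariant s Y) {k m : ℕ} (e : ℕ) (hm : m ≤ e + nprime r s k) :
    (dig r X k).card * (dig s Y m).card ≤ s ^ e * FF r s X Y k := by
  have h1 := dig_card_mono (r := s) (by omega) (X := Y) hm
  have h2 := dig_card_add (by omega : 2 ≤ s) hY e (nprime r s k)
  unfold FF
  calc _ ≤ (dig r X k).card * (s ^ e * (dig s Y (nprime r s k)).card) :=
        Nat.mul_le_mul_left _ (h1.trans h2)
    _ = _ := by ring

theorem near_prod_card {r s : ℕ} (hr : 2 ≤ r) (hrs : r < s) {X Y : Set ℝ}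
    (hX : TimesInvariant r X) (hY : TimesInvariant s Y) {k n M : ℕ} (e : ℕ) (hnk : n ≤ k)
    (hM1 : nprime r s k ≤ M) (hM2 : M ≤ nprime r s k + e) (u v : ℤ) :
    (near r X k n u ×ˢ near s Y M (nprime r s n) v).card
      ≤ 9 * s ^ (e + 1) * FF r s X Y (k - n) := by
  rw [Finset.card_product]
  have h1 := card_near hr hX hnk u
  have h2 := card_near (by omega : 2 ≤ s) hY ((nprime_mono hr hrs hnk).trans hM1) v
  have h3 := nprime_sub hr hrs hnk
  have h4 := FF_shift hr hrs (X := X) hY (k := k - n) (m := M - nprime r s n) (e + 1) (by omega)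
  calc _ ≤ _ := Nat.mul_le_mul h1 h2
    _ = 9 * ((dig r X (k - n)).card * (dig s Y (M - nprime r s n)).card) := by ring
    _ ≤ 9 * (s ^ (e + 1) * FF r s X Y (k - n)) := Nat.mul_le_mul_left _ h4
    _ = _ := by ring

theorem exists_level {r : ℕ} (hr : 2 ≤ r) {t : ℝ} (ht : 0 < t) {d η : ℝ} (hd : 0 ≤ d)
    (hd1 : d ≤ 1 / (2 * r)) (hη : 0 < η) :
    ∃ n : ℕ, 1 ≤ n ∧ d < ((r : ℝ) ^ n)⁻¹ ∧
      (((r : ℝ) ^ n)⁻¹) ^ t ≤ (2 * r) ^ t * d ^ t + η := by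
  have hr0 : (0 : ℝ) < r := by positivity
  have hr1 : (1 : ℝ) < r := by exact_mod_cast hr
  rcases hd.eq_or_lt with rfl | hd
  · obtain ⟨n, hn⟩ := exists_pow_lt_of_lt_one (Real.rpow_pos_of_pos hη (1 / t))
      (inv_lt_one_of_one_lt₀ hr1)
    refine ⟨n + 1, by omega, by positivity, ?_⟩
    rw [Real.zero_rpow ht.ne', mul_zero, zero_add]
    have h1 : ((r : ℝ) ^ (n + 1))⁻¹ ≤ η ^ (1 / t) := by
      refine le_trans ?_ hn.le
      rw [inv_pow]
      gcongr
      · exact hr1.le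
      · omega
    calc _ ≤ (η ^ (1 / t)) ^ t := by gcongr
      _ = η := by
        rw [← Real.rpow_mul hη.le, one_div, inv_mul_cancel₀ ht.ne', Real.rpow_one]
  · have h2 : (r : ℝ) ≤ 1 / (2 * d) := by
      rw [le_div_iff₀ (by positivity)] at hd1 ⊢
      linarith
    obtain ⟨n, hn1, hn2⟩ := exists_nat_pow_near (hr1.le.trans h2) hr1
    have hp : (0 : ℝ) < (r : ℝ) ^ n := by positivity
    refine ⟨n, ?_, ?_, ?_⟩
    · by_contra h
      have : n = 0 := by omega
      subst this
      simp only [zero_add, pow_one] at hn2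
      linarith
    · rw [le_div_iff₀ (by positivity)] at hn1
      rw [lt_inv_comm₀ hd hp, ← one_div, lt_div_iff₀ hd]
      nlinarith
    · have h3 : ((r : ℝ) ^ n)⁻¹ ≤ 2 * r * d := by
        rw [div_lt_iff₀ (by positivity), pow_succ] at hn2
        rw [inv_le_iff_one_le_mul₀ hp]
        nlinarith
      calc _ ≤ (2 * r * d) ^ t := by gcongr
        _ = (2 * r) ^ t * d ^ t := by rw [Real.mul_rpow (by positivity) hd.le]
        _ ≤ _ := by linarith

open MeasureTheory in
theorem exists_cover {r : ℕ} (hr : 2 ≤ r) {t : ℝ} (ht : 0 < t) {K : Set (ℝ × ℝ)}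
    (hK : IsCompact K) (h0 : μH[t] K = 0) {ε : ℝ} (hε : 0 < ε) :
    ∃ (I : Finset ℕ) (n : ℕ → ℕ) (p : ℕ → ℝ × ℝ), (∀ i, 1 ≤ n i) ∧
      (K ⊆ ⋃ i ∈ I, Metric.ball (p i) ((r : ℝ) ^ n i)⁻¹) ∧
      ∑ i ∈ I, (((r : ℝ) ^ n i)⁻¹) ^ t ≤ ε := by
  have hr0 : (0 : ℝ) < r := by positivity
  set c : ℝ := (2 * r) ^ t with hc
  have hcpos : 0 < c := by positivity
  rw [Measure.hausdorffMeasure_apply] at h0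
  have h1 := le_of_eq h0
  rw [iSup₂_le_iff] at h1
  have h2 := h1 (ENNReal.ofReal (1 / (2 * r))) (by simp; positivity)
  have h3 := lt_of_le_of_lt h2 (show (0 : ENNReal) < ENNReal.ofReal (ε / (2 * c)) by
    simp; positivity)
  simp only [iInf_lt_iff] at h3
  obtain ⟨S, hS1, hS2, hS3⟩ := h3
  have hfin : ∀ i, Metric.ediam (S i) ≠ ⊤ := fun i => ne_top_of_le_ne_top ENNReal.ofReal_ne_top (hS2 i)
  have hd : ∀ i, (Metric.ediam (S i)).toReal ≤ 1 / (2 * r) := fun i =>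
    ENNReal.toReal_le_of_le_ofReal (by positivity) (hS2 i)
  choose n hn1 hn2 hn3 using fun i : ℕ => exists_level hr ht
    (d := (Metric.ediam (S i)).toReal) (η := ε / 2 / 2 ^ (i + 1)) ENNReal.toReal_nonneg (hd i)
    (by positivity)
  have hp : ∀ i, ∃ p : ℝ × ℝ, S i ⊆ Metric.ball p ((r : ℝ) ^ n i)⁻¹ := by
    intro i
    rcases (S i).eq_empty_or_nonempty with he | ⟨p, hp⟩
    · exact ⟨0, by simp [he]⟩
    · refine ⟨p, fun q hq => ?_⟩
      rw [Metric.mem_ball, dist_edist]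
      refine lt_of_le_of_lt ?_ (hn2 i)
      exact ENNReal.toReal_mono (hfin i) (Metric.edist_le_ediam_of_mem hq hp)
  choose p hp using hp
  obtain ⟨I, hI⟩ := hK.elim_finite_subcover (fun i => Metric.ball (p i) ((r : ℝ) ^ n i)⁻¹)
    (fun i => Metric.isOpen_ball) (hS1.trans (Set.iUnion_mono hp))
  refine ⟨I, n, p, hn1, hI, ?_⟩
  have hsum1 : ∑ i ∈ I, (Metric.ediam (S i)).toReal ^ t ≤ ε / (2 * c) := by
    have : ENNReal.ofReal (∑ i ∈ I, (Metric.ediam (S i)).toReal ^ t)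
        ≤ ENNReal.ofReal (ε / (2 * c)) := by
      rw [ENNReal.ofReal_sum_of_nonneg (fun i _ => by positivity)]
      refine le_trans ?_ hS3.le
      refine le_trans (Finset.sum_le_sum ?_) (ENNReal.sum_le_tsum I)
      intro i _
      rw [ENNReal.toReal_rpow, ENNReal.ofReal_toReal (ENNReal.rpow_ne_top_of_nonneg ht.le (hfin i))]
      rcases (S i).eq_empty_or_nonempty with he | hne
      · simp [he, ht]
      · exact le_iSup (fun _ : (S i).Nonempty => Metric.ediam (S i) ^ t) hne
    exact (ENNReal.ofReal_le_ofReal_iff (by positivity)).1 this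
  have hsum2 : ∑ i ∈ I, ε / 2 / 2 ^ (i + 1) ≤ ε / 2 := by
    have := (hasSum_geometric_two' (ε / 2)).summable.sum_le_tsum I (fun i _ => by positivity)
    rw [tsum_geometric_two'] at this
    refine le_trans (le_of_eq (Finset.sum_congr rfl fun i _ => ?_)) this
    rw [pow_succ]; field_simp
  calc _ ≤ ∑ i ∈ I, (c * (Metric.ediam (S i)).toReal ^ t + ε / 2 / 2 ^ (i + 1)) :=
        Finset.sum_le_sum fun i _ => hn3 i
    _ = c * ∑ i ∈ I, (Metric.ediam (S i)).toReal ^ t + ∑ i ∈ I, ε / 2 / 2 ^ (i + 1) := by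
        rw [Finset.sum_add_distrib, Finset.mul_sum]
    _ ≤ c * (ε / (2 * c)) + ε / 2 := by gcongr
    _ = ε := by field_simp; ring

open MeasureTheory in
theorem FF_upper {r s : ℕ} (hr : 2 ≤ r) (hrs : r < s) {X Y : Set ℝ}
    (hX : TimesInvariant r X) (hY : TimesInvariant s Y) {t : ℝ} (ht : 0 < t)
    (h0 : μH[t] (X ×ˢ Y) = 0) :
    ∃ C : ℝ, 0 < C ∧ ∀ k : ℕ, (FF r s X Y k : ℝ) ≤ C * ((r : ℝ) ^ k) ^ t := by
  have hr0 : (0 : ℝ) < r := by positivity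
  have hr1 : (1 : ℝ) ≤ r := by exact_mod_cast (by omega : 1 ≤ r)
  have hs0 : (0 : ℝ) < s := by exact_mod_cast (by omega : 0 < s)
  have hK : IsCompact (X ×ˢ Y) :=
    (isCompact_Icc.of_isClosed_subset hX.2.1 hX.1).prod
      (isCompact_Icc.of_isClosed_subset hY.2.1 hY.1)
  obtain ⟨I, n, p, hn1, hcov, hsum⟩ := exists_cover hr ht hK h0
    (ε := 1 / (9 * s)) (by positivity)
  set m := I.sup n with hm
  have hrec : ∀ k, m ≤ k → FF r s X Y k ≤ ∑ i ∈ I, 9 * s * FF r s X Y (k - n i) := by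
    classical
    intro k hk
    have hnk : ∀ i ∈ I, n i ≤ k := fun i hi => (Finset.le_sup hi).trans hk
    have hsub : dig r X k ×ˢ dig s Y (nprime r s k) ⊆ I.biUnion (fun i =>
        near r X k (n i) ⌊(p i).1 * (r : ℝ) ^ n i⌋ ×ˢ
        near s Y (nprime r s k) (nprime r s (n i)) ⌊(p i).2 * (s : ℝ) ^ nprime r s (n i)⌋) := by
      rintro ⟨a, b⟩ hab
      rw [Finset.mem_product, mem_dig hr, mem_dig (by omega)] at hab
      obtain ⟨⟨x, hx, hx1, rfl⟩, ⟨y, hy, hy1, hb⟩⟩ := hab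
      simp only at hb
      subst hb
      have := hcov (Set.mk_mem_prod hx hy)
      simp only [Set.mem_iUnion] at this
      obtain ⟨i, hi, hb⟩ := this
      rw [Metric.mem_ball, Prod.dist_eq, max_lt_iff, Real.dist_eq, Real.dist_eq] at hb
      have hpos : (0 : ℝ) < (r : ℝ) ^ n i := by positivity
      rw [Finset.mem_biUnion]
      refine ⟨i, hi, Finset.mem_product.2 ⟨?_, ?_⟩⟩
      · apply mem_near hr hX (hnk i hi) hx hx1
        have := hb.1.le
        rwa [← one_div, le_div_iff₀ hpos] at this
      · apply mem_near (by omega) hY (nprime_mono hr hrs (hnk i hi)) hy hy1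
        have := hb.2.le
        rw [← one_div, le_div_iff₀ hpos] at this
        refine le_trans ?_ this
        have h5 : ((s : ℝ)) ^ nprime r s (n i) ≤ (r : ℝ) ^ n i := by
          exact_mod_cast nprime_le hr hrs (n i)
        gcongr
    have := Finset.card_le_card hsub
    rw [Finset.card_product] at this
    refine this.trans (Finset.card_biUnion_le.trans (Finset.sum_le_sum fun i hi => ?_))
    simpa using near_prod_card hr hrs hX hY 0 (hnk i hi) le_rfl (by omega) _ _
  refine ⟨(r : ℝ) ^ m * (s : ℝ) ^ m, by positivity, ?_⟩
  intro k
  induction k using Nat.strong_induction_on with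
  | _ k ih =>
  by_cases hk : m ≤ k ∧ 1 ≤ k
  · have h1 : (FF r s X Y k : ℝ) ≤ ∑ i ∈ I, 9 * s * (FF r s X Y (k - n i) : ℝ) := by
      exact_mod_cast hrec k hk.1
    refine h1.trans ?_
    have hnk : ∀ i ∈ I, n i ≤ k := fun i hi => (Finset.le_sup hi).trans hk.1
    calc _ ≤ ∑ i ∈ I, 9 * s * ((r : ℝ) ^ m * (s : ℝ) ^ m * ((r : ℝ) ^ (k - n i)) ^ t) := by
          refine Finset.sum_le_sum fun i hi => ?_
          have := ih (k - n i) (by have := hn1 i; omega)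
          gcongr
      _ = ∑ i ∈ I, (9 * s * ((r : ℝ) ^ m * (s : ℝ) ^ m * ((r : ℝ) ^ k) ^ t))
            * (((r : ℝ) ^ n i)⁻¹) ^ t := by
          refine Finset.sum_congr rfl fun i hi => ?_
          have : ((r : ℝ) ^ (k - n i)) = (r : ℝ) ^ k * ((r : ℝ) ^ n i)⁻¹ :=
            pow_sub₀ _ hr0.ne' (hnk i hi)
          rw [this, Real.mul_rpow (by positivity) (by positivity)]
          ring
      _ = (9 * s * ((r : ℝ) ^ m * (s : ℝ) ^ m * ((r : ℝ) ^ k) ^ t))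
            * ∑ i ∈ I, (((r : ℝ) ^ n i)⁻¹) ^ t := by rw [Finset.mul_sum]
      _ ≤ (9 * s * ((r : ℝ) ^ m * (s : ℝ) ^ m * ((r : ℝ) ^ k) ^ t)) * (1 / (9 * s)) := by
          gcongr
      _ = _ := by field_simp
  · have hkm : k ≤ m := by omega
    have h1 : FF r s X Y k ≤ r ^ m * s ^ m := by
      unfold FF
      refine Nat.mul_le_mul ?_ ?_
      · exact (dig_card_le_pow r X k).trans (Nat.pow_le_pow_right (by omega) hkm)
      · exact (dig_card_le_pow s Y _).trans (Nat.pow_le_pow_right (by omega)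
          ((nprime_le_self hr hrs k).trans hkm))
    have h2 : (1 : ℝ) ≤ ((r : ℝ) ^ k) ^ t := Real.one_le_rpow (one_le_pow₀ hr1) ht.le
    calc (FF r s X Y k : ℝ) ≤ (r : ℝ) ^ m * (s : ℝ) ^ m := by exact_mod_cast h1
      _ ≤ _ := le_mul_of_one_le_right (by positivity) h2

theorem dig_nonempty {r : ℕ} (hr : 2 ≤ r) {X : Set ℝ} (hX : TimesInvariant r X)
    (hne : X.Nonempty) (n : ℕ) : 1 ≤ (dig r X n).card := by
  obtain ⟨x, hx⟩ := hne
  exact Finset.card_pos.2 ⟨_, (mem_dig hr).2 ⟨_, hX.2.2 x hx, Int.fract_lt_one _, rfl⟩⟩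

theorem mem_cell {r : ℕ} (hr : 2 ≤ r) {X : Set ℝ} (hX : TimesInvariant r X) (n : ℕ)
    {x : ℝ} (hx : x ∈ X) : ∃ i ∈ insert (r ^ n) (dig r X n),
      x ∈ Set.Icc ((i : ℝ) / (r : ℝ) ^ n) (((i : ℝ) + 1) / (r : ℝ) ^ n) := by
  have hp : (0 : ℝ) < (r : ℝ) ^ n := by positivity
  have h01 := hX.1 hx
  rcases h01.2.eq_or_lt with rfl | h1
  · refine ⟨r ^ n, Finset.mem_insert_self _ _, ?_, ?_⟩
    · rw [div_le_iff₀ hp]; push_cast; linarith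
    · rw [le_div_iff₀ hp]; push_cast; linarith
  · refine ⟨⌊x * (r : ℝ) ^ n⌋₊, Finset.mem_insert_of_mem ((mem_dig hr).2 ⟨x, hx, h1, rfl⟩), ?_, ?_⟩
    · rw [div_le_iff₀ hp]; exact Nat.floor_le (mul_nonneg h01.1 hp.le)
    · rw [le_div_iff₀ hp]; exact (Nat.lt_floor_add_one _).le

open MeasureTheory in
theorem FF_lower {r s : ℕ} (hr : 2 ≤ r) (hrs : r < s) {X Y : Set ℝ}
    (hX : TimesInvariant r X) (hY : TimesInvariant s Y) (hXn : X.Nonempty) (hYn : Y.Nonempty)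
    {t : ℝ} (ht : 0 < t) (h0 : μH[t] (X ×ˢ Y) = ⊤) :
    ∀ᶠ N : ℕ in Filter.atTop, ((r : ℝ) ^ N) ^ t ≤ (FF r s X Y N : ℝ) := by
  have hr0 : (0 : ℝ) < r := by positivity
  have hr1 : (1 : ℝ) < r := by exact_mod_cast (by omega : 1 < r)
  have hs0 : (0 : ℝ) < s := by exact_mod_cast (by omega : 0 < s)
  have hs1 : (1 : ℝ) < s := by exact_mod_cast (by omega : 1 < s)
  by_contra hcon
  rw [Filter.not_eventually] at hcon
  let J : ℕ → Finset (ℕ × ℕ) := fun N =>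
    insert (r ^ N) (dig r X N) ×ˢ insert (s ^ nprime r s N) (dig s Y (nprime r s N))
  let T : ∀ N : ℕ, J N → Set (ℝ × ℝ) := fun N q =>
    Set.Icc ((q.1.1 : ℝ) / (r : ℝ) ^ N) (((q.1.1 : ℝ) + 1) / (r : ℝ) ^ N) ×ˢ
    Set.Icc ((q.1.2 : ℝ) / (s : ℝ) ^ nprime r s N) (((q.1.2 : ℝ) + 1) / (s : ℝ) ^ nprime r s N)
  have hT : ∀ N q, Metric.ediam (T N q) ≤ ENNReal.ofReal (s / (r : ℝ) ^ N) := by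
    intro N q
    have hp : (0 : ℝ) < (r : ℝ) ^ N := by positivity
    have hq : (0 : ℝ) < (s : ℝ) ^ nprime r s N := by positivity
    have hl : (r : ℝ) ^ N ≤ (s : ℝ) ^ nprime r s N * s := by
      rw [← pow_succ]; exact_mod_cast (lt_nprime hr hrs N).le
    apply Metric.ediam_le
    rintro ⟨x1, x2⟩ ⟨⟨a1, a2⟩, ⟨a3, a4⟩⟩ ⟨y1, y2⟩ ⟨⟨b1, b2⟩, ⟨b3, b4⟩⟩
    rw [edist_dist]
    apply ENNReal.ofReal_le_ofReal
    simp only [add_div] at a1 a2 a3 a4 b1 b2 b3 b4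
    have e1 : 1 / (r : ℝ) ^ N ≤ s / (r : ℝ) ^ N := by gcongr
    have e2 : 1 / (s : ℝ) ^ nprime r s N ≤ s / (r : ℝ) ^ N := by
      rw [div_le_div_iff₀ hq hp]; linarith
    rw [Prod.dist_eq, Real.dist_eq, Real.dist_eq]
    refine max_le (abs_le.2 ⟨?_, ?_⟩) (abs_le.2 ⟨?_, ?_⟩) <;> simp only <;> linarith
  have hlim : Filter.Tendsto (fun N : ℕ => ENNReal.ofReal (s / (r : ℝ) ^ N)) Filter.atTop
      (nhds 0) := by
    rw [← ENNReal.ofReal_zero]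
    apply ENNReal.tendsto_ofReal
    exact tendsto_const_nhds.div_atTop (tendsto_pow_atTop_atTop_of_one_lt hr1)
  have key := Measure.hausdorffMeasure_le_liminf_sum (X := ℝ × ℝ) t (X ×ˢ Y)
    (fun N : ℕ => ENNReal.ofReal (s / (r : ℝ) ^ N)) hlim T
    (Filter.Eventually.of_forall hT) (Filter.Eventually.of_forall (by
      rintro N ⟨x, y⟩ ⟨hx, hy⟩
      obtain ⟨i, hi, hi'⟩ := mem_cell hr hX N hx
      obtain ⟨j, hj, hj'⟩ := mem_cell (by omega) hY (nprime r s N) hy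
      rw [Set.mem_iUnion]
      exact ⟨⟨(i, j), Finset.mem_product.2 ⟨hi, hj⟩⟩, hi', hj'⟩))
  rw [h0, top_le_iff] at key
  have hle : Filter.liminf (fun N => ∑ i, Metric.ediam (T N i) ^ t) Filter.atTop
      ≤ ENNReal.ofReal (4 * (s : ℝ) ^ t) := by
    apply Filter.liminf_le_of_frequently_le'
    refine hcon.mono fun N hN => ?_
    rw [not_le] at hN
    have hp : (0 : ℝ) < (r : ℝ) ^ N := by positivity
    have hJ : (J N).card ≤ 4 * FF r s X Y N := by
      have h1 := dig_nonempty hr hX hXn N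
      have h2 := dig_nonempty (by omega) hY hYn (nprime r s N)
      have h3 := Finset.card_insert_le (r ^ N) (dig r X N)
      have h4 := Finset.card_insert_le (s ^ nprime r s N) (dig s Y (nprime r s N))
      simp only [J, Finset.card_product, FF]
      calc _ ≤ (2 * (dig r X N).card) * (2 * (dig s Y (nprime r s N)).card) :=
            Nat.mul_le_mul (by omega) (by omega)
        _ = _ := by ring
    have hJ' : ((J N).card : ℝ) ≤ 4 * FF r s X Y N := by exact_mod_cast hJ
    calc ∑ i, Metric.ediam (T N i) ^ t
        ≤ ∑ i : J N, ENNReal.ofReal ((s / (r : ℝ) ^ N) ^ t) := by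
          refine Finset.sum_le_sum fun i _ => ?_
          rw [← ENNReal.ofReal_rpow_of_nonneg (by positivity) ht.le]
          exact ENNReal.rpow_le_rpow (hT N i) ht.le
      _ = ENNReal.ofReal ((J N).card * (s / (r : ℝ) ^ N) ^ t) := by
          rw [Finset.sum_const, Finset.card_univ, Fintype.card_coe, nsmul_eq_mul,
            ENNReal.ofReal_mul (by positivity), ENNReal.ofReal_natCast]
      _ ≤ _ := by
          apply ENNReal.ofReal_le_ofReal
          calc _ ≤ (4 * ((r : ℝ) ^ N) ^ t) * (s / (r : ℝ) ^ N) ^ t := by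
                gcongr; linarith
            _ = _ := by
                rw [Real.div_rpow hs0.le hp.le]
                have : (0 : ℝ) < ((r : ℝ) ^ N) ^ t := by positivity
                field_simp
  rw [key] at hle
  exact absurd (top_le_iff.1 hle) ENNReal.ofReal_ne_top

theorem prodSet_eq {r s : ℕ} (hr : 2 ≤ r) (hs : 2 ≤ s) {X Y : Set ℝ}
    (hX : TimesInvariant r X) (hY : TimesInvariant s Y) (N M : ℕ) :
    prodSet (approx r X N) (approx s Y M) =
      (fun q : ℕ × ℕ => (!₂[(q.1 : ℝ) / (r : ℝ) ^ N, (q.2 : ℝ) / (s : ℝ) ^ M] :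
        EuclideanSpace ℝ (Fin 2))) '' ((dig r X N ×ˢ dig s Y M : Finset (ℕ × ℕ)) : Set (ℕ × ℕ)) := by
  rw [approx_eq hr hX, approx_eq hs hY]
  ext p
  constructor
  · rintro ⟨⟨i, hi, h1⟩, ⟨j, hj, h2⟩⟩
    refine ⟨(i, j), ?_, ?_⟩
    · simpa using ⟨hi, hj⟩
    · ext a
      fin_cases a
      · simpa using h1
      · simpa using h2
  · rintro ⟨⟨i, j⟩, hij, rfl⟩
    simp only [Finset.coe_product, Set.mem_prod] at hij
    exact ⟨⟨i, hij.1, by simp⟩, ⟨j, hij.2, by simp⟩⟩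

theorem prodSet_ncard {r s : ℕ} (hr : 2 ≤ r) (hs : 2 ≤ s) {X Y : Set ℝ}
    (hX : TimesInvariant r X) (hY : TimesInvariant s Y) (N M : ℕ) :
    (prodSet (approx r X N) (approx s Y M)).ncard = (dig r X N).card * (dig s Y M).card := by
  rw [prodSet_eq hr hs hX hY, Set.ncard_image_of_injective, Set.ncard_coe_finset,
    Finset.card_product]
  rintro ⟨i, j⟩ ⟨i', j'⟩ h
  have hp : ((r : ℝ) ^ N) ≠ 0 := by positivity
  have hq : ((s : ℝ) ^ M) ≠ 0 := by positivity
  have h0 := congrArg (fun p : EuclideanSpace ℝ (Fin 2) => p 0) h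
  have h1 := congrArg (fun p : EuclideanSpace ℝ (Fin 2) => p 1) h
  simp only [Matrix.cons_val_zero, Matrix.cons_val_one] at h0 h1
  rw [div_left_inj' hp] at h0
  rw [div_left_inj' hq] at h1
  ext
  · exact_mod_cast h0
  · exact_mod_cast h1

theorem coord_le (x y : EuclideanSpace ℝ (Fin 2)) (a : Fin 2) : |x a - y a| ≤ dist x y := by
  rw [dist_eq_norm]
  simpa using PiLp.norm_apply_le (x - y) a

theorem nat_sep {i j : ℕ} (h : i ≠ j) {d : ℝ} (hd : 0 < d) :
    d⁻¹ ≤ |(i : ℝ) / d - (j : ℝ) / d| := by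
  rw [← sub_div, abs_div, abs_of_pos hd, ← one_div]
  gcongr
  have : (1 : ℤ) ≤ |(i : ℤ) - j| := Int.one_le_abs (by omega)
  exact_mod_cast this

theorem rgc_main {r s : ℕ} (hr : 2 ≤ r) (hrs : r < s) {X Y : Set ℝ}
    (hX : TimesInvariant r X) (hY : TimesInvariant s Y) {t C : ℝ} (ht : 0 < t) (hC : 0 < C)
    (hF : ∀ k : ℕ, (FF r s X Y k : ℝ) ≤ C * ((r : ℝ) ^ k) ^ t) (N M : ℕ)
    (hM1 : nprime r s N ≤ M) (hM2 : M ≤ nprime r s N + 1) :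
    IsRGCSet ((s : ℝ)⁻¹ * ((r : ℝ) ^ N)⁻¹) t (9 * s ^ 2 * C)
      (prodSet (approx r X N) (approx s Y M)) := by
  have hr0 : (0 : ℝ) < r := by positivity
  have hr1 : (1 : ℝ) < r := by exact_mod_cast (by omega : 1 < r)
  have hs0 : (0 : ℝ) < s := by exact_mod_cast (by omega : 0 < s)
  have hs1 : (1 : ℝ) < s := by exact_mod_cast (by omega : 1 < s)
  have hrs' : (r : ℝ) ≤ s := by exact_mod_cast hrs.le
  have hp : (0 : ℝ) < (r : ℝ) ^ N := by positivity
  have hq : (0 : ℝ) < (s : ℝ) ^ M := by positivity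
  constructor
  · rw [prodSet_eq hr (by omega) hX hY]
    rintro _ ⟨⟨i, j⟩, -, rfl⟩ _ ⟨⟨i', j'⟩, -, rfl⟩ hne
    by_cases hi : i = i'
    · have hj : j ≠ j' := by
        rintro rfl; subst hi; exact hne rfl
      refine le_trans ?_ (coord_le _ _ 1)
      simp only [Matrix.cons_val_one]
      refine le_trans ?_ (nat_sep hj hq)
      rw [← mul_inv]
      apply inv_anti₀ hq
      have h1 : s ^ M ≤ s * r ^ N := by
        calc s ^ M ≤ s ^ (nprime r s N + 1) := Nat.pow_le_pow_right (by omega) hM2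
          _ = s * s ^ nprime r s N := by ring
          _ ≤ _ := Nat.mul_le_mul_left _ (nprime_le hr hrs N)
      exact_mod_cast h1
    · refine le_trans ?_ (coord_le _ _ 0)
      simp only [Matrix.cons_val_zero]
      refine le_trans ?_ (nat_sep hi hp)
      exact mul_le_of_le_one_left (by positivity) (inv_le_one_of_one_le₀ hs1.le)
  · intro δ hδ x
    have hδ0 : 0 < δ := lt_of_lt_of_le (by positivity) hδ
    have hδρ : δ / ((s : ℝ)⁻¹ * ((r : ℝ) ^ N)⁻¹) = s * (δ * (r : ℝ) ^ N) := by
      field_simp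
    have h1s : 1 ≤ s * (δ * (r : ℝ) ^ N) := by
      rw [← hδρ, one_le_div (by positivity)]; exact hδ
    rw [hδρ]
    -- the scale
    have hex : ∃ k : ℕ, δ * (r : ℝ) ^ N ≤ (r : ℝ) ^ k := by
      obtain ⟨k, hk⟩ := pow_unbounded_of_one_lt (δ * (r : ℝ) ^ N) hr1
      exact ⟨k, hk.le⟩
    classical
    set k := Nat.find hex with hk
    have hk1 : δ * (r : ℝ) ^ N ≤ (r : ℝ) ^ k := Nat.find_spec hex
    have hk2 : (r : ℝ) ^ k ≤ s * (δ * (r : ℝ) ^ N) := by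
      rcases Nat.eq_zero_or_pos k with h | h
      · rw [h, pow_zero]; exact h1s
      · have := Nat.find_min hex (m := k - 1) (by omega)
        rw [not_le] at this
        have h2 : (r : ℝ) ^ k = r * (r : ℝ) ^ (k - 1) := by
          rw [← pow_succ']; congr 1; omega
        rw [h2]
        gcongr
    have hcount : (prodSet (approx r X N) (approx s Y M) ∩ Metric.ball x (δ / 2)).ncard
        ≤ 9 * s ^ 2 * FF r s X Y (min k N) := by
      by_cases hkN : k ≤ N
      · rw [min_eq_left hkN]
        obtain ⟨n, hn⟩ : ∃ n, n = N - k := ⟨_, rfl⟩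
        have hnN : n ≤ N := by omega
        have hball : δ / 2 * (r : ℝ) ^ n ≤ 1 := by
          have h3 : (r : ℝ) ^ N = (r : ℝ) ^ n * (r : ℝ) ^ k := by
            rw [← pow_add]; congr 1; omega
          have h4 : (0 : ℝ) < (r : ℝ) ^ k := by positivity
          have h5 : (0 : ℝ) < (r : ℝ) ^ n := by positivity
          rw [h3, ← mul_assoc] at hk1
          have : δ * (r : ℝ) ^ n ≤ 1 := le_of_mul_le_mul_right (by linarith) h4
          nlinarith [mul_pos hδ0 h5]
        have hsub : prodSet (approx r X N) (approx s Y M) ∩ Metric.ball x (δ / 2) ⊆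
            (fun q : ℕ × ℕ => (!₂[(q.1 : ℝ) / (r : ℝ) ^ N, (q.2 : ℝ) / (s : ℝ) ^ M] :
              EuclideanSpace ℝ (Fin 2))) ''
              ((near r X N n ⌊x 0 * (r : ℝ) ^ n⌋ ×ˢ
                near s Y M (nprime r s n) ⌊x 1 * (s : ℝ) ^ nprime r s n⌋ :
                Finset (ℕ × ℕ)) : Set (ℕ × ℕ)) := by
          rw [prodSet_eq hr (by omega) hX hY]
          rintro _ ⟨⟨⟨i, j⟩, hij, rfl⟩, hb⟩
          refine ⟨(i, j), ?_, rfl⟩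
          rw [Metric.mem_ball] at hb
          have c0 := (coord_le _ _ 0).trans hb.le
          have c1 := (coord_le _ _ 1).trans hb.le
          simp only [Matrix.cons_val_zero, Matrix.cons_val_one] at c0 c1
          simp only [Finset.coe_product, Set.mem_prod, Finset.mem_coe] at hij ⊢
          refine ⟨mem_near' hr hnN hij.1 ?_, mem_near' (by omega)
            ((nprime_mono hr hrs hnN).trans hM1) hij.2 ?_⟩
          · refine le_trans ?_ hball
            gcongr
          · refine le_trans ?_ hball
            have h5 : ((s : ℝ)) ^ nprime r s n ≤ (r : ℝ) ^ n := by
              exact_mod_cast nprime_le hr hrs n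
            gcongr
        refine (Set.ncard_le_ncard hsub ((Finset.finite_toSet _).image _)).trans ?_
        refine (Set.ncard_image_le (Finset.finite_toSet _)).trans ?_
        rw [Set.ncard_coe_finset]
        have := near_prod_card hr hrs hX hY 1 hnN hM1 hM2 ⌊x 0 * (r : ℝ) ^ n⌋
          ⌊x 1 * (s : ℝ) ^ nprime r s n⌋
        have hNn : N - n = k := by omega
        rwa [hNn] at this
      · rw [min_eq_right (by omega)]
        have hfin : (prodSet (approx r X N) (approx s Y M)).Finite := by
          rw [prodSet_eq hr (by omega) hX hY]
          exact (Finset.finite_toSet _).image _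
        refine (Set.ncard_le_ncard Set.inter_subset_left hfin).trans ?_
        rw [prodSet_ncard hr (by omega) hX hY]
        refine (FF_shift hr hrs hY 1 (by omega)).trans ?_
        apply Nat.mul_le_mul_right
        nlinarith
    calc ((prodSet (approx r X N) (approx s Y M) ∩ Metric.ball x (δ / 2)).ncard : ℝ)
        ≤ 9 * s ^ 2 * (FF r s X Y (min k N) : ℝ) := by exact_mod_cast hcount
      _ ≤ 9 * s ^ 2 * (C * ((r : ℝ) ^ (min k N)) ^ t) := by
          gcongr; exact hF _
      _ ≤ 9 * s ^ 2 * (C * (s * (δ * (r : ℝ) ^ N)) ^ t) := by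
          gcongr
          refine le_trans ?_ hk2
          exact pow_le_pow_right₀ hr1.le (min_le_left _ _)
      _ = _ := by ring

theorem product_of_approx_is_discrete_fractal
    (r s : ℕ) (hr : 2 ≤ r) (hrs : r < s)
    (X Y : Set ℝ) (hX : TimesInvariant r X) (hY : TimesInvariant s Y)
    (hdX : 0 < dimH X) (hdY : 0 < dimH Y)
    (γ₄ γ₅ : ℝ) (h4 : 0 < γ₄)
    (h4d : γ₄ < (dimH (X ×ˢ Y)).toReal)
    (hd5 : (dimH (X ×ˢ Y)).toReal < γ₅) :
    ∃ c₁ c₂ : ℝ, 0 < c₁ ∧ 0 < c₂ ∧ ∃ N₁ : ℕ, ∀ N : ℕ, N₁ ≤ N →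
      IsRGCSet (c₁ * ((r : ℝ) ^ N)⁻¹) γ₅ c₂
          (prodSet (approx r X N) (approx s Y (nprime r s N))) ∧
      IsRGCSet (c₁ * ((r : ℝ) ^ N)⁻¹) γ₅ c₂
          (prodSet (approx r X N) (approx s Y (nprime r s N + 1))) ∧
      (r : ℝ) ^ ((N : ℝ) * γ₄) ≤
          ((prodSet (approx r X N) (approx s Y (nprime r s N))).ncard : ℝ) ∧
      ((prodSet (approx r X N) (approx s Y (nprime r s N))).ncard : ℝ) ≤
          (r : ℝ) ^ ((N : ℝ) * γ₅) ∧
      (r : ℝ) ^ ((N : ℝ) * γ₄) ≤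
          ((prodSet (approx r X N) (approx s Y (nprime r s N + 1))).ncard : ℝ) ∧
      ((prodSet (approx r X N) (approx s Y (nprime r s N + 1))).ncard : ℝ) ≤
          (r : ℝ) ^ ((N : ℝ) * γ₅) := by
  have hs2 : 2 ≤ s := by omega
  have hr1 : (1 : ℝ) < r := by exact_mod_cast (by omega : 1 < r)
  have hs0 : (0 : ℝ) < s := by exact_mod_cast (by omega : 0 < s)
  have hfin : dimH (X ×ˢ Y) ≠ ⊤ := by
    have h1 : dimH (X ×ˢ Y) ≤ dimH (Set.univ : Set (ℝ × ℝ)) := dimH_mono (Set.subset_univ _)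
    rw [Real.dimH_univ_eq_finrank] at h1
    exact ne_top_of_le_ne_top (ENNReal.natCast_ne_top _) h1
  set D := (dimH (X ×ˢ Y)).toReal with hD
  have hDD : dimH (X ×ˢ Y) = ENNReal.ofReal D := (ENNReal.ofReal_toReal hfin).symm
  have hD0 : 0 < D := h4.trans h4d
  have hXn : X.Nonempty := by
    rw [Set.nonempty_iff_ne_empty]; rintro rfl; simp at hdX
  have hYn : Y.Nonempty := by
    rw [Set.nonempty_iff_ne_empty]; rintro rfl; simp at hdY
  have hlow : MeasureTheory.Measure.hausdorffMeasure γ₄ (X ×ˢ Y) = ⊤ := by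
    have := hausdorffMeasure_of_lt_dimH (s := X ×ˢ Y) (d := γ₄.toNNReal) (by
      rw [hDD]; exact (ENNReal.ofReal_lt_ofReal_iff hD0).2 h4d)
    rwa [Real.coe_toNNReal _ h4.le] at this
  obtain ⟨t, ht1, ht2⟩ := exists_between hd5
  have ht0 : 0 < t := hD0.trans ht1
  have hup : ∀ u : ℝ, D < u → MeasureTheory.Measure.hausdorffMeasure u (X ×ˢ Y) = 0 := by
    intro u hu
    have hu0 : 0 < u := hD0.trans hu
    have := hausdorffMeasure_of_dimH_lt (s := X ×ˢ Y) (d := u.toNNReal) (by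
      rw [hDD]; exact (ENNReal.ofReal_lt_ofReal_iff hu0).2 hu)
    rwa [Real.coe_toNNReal _ hu0.le] at this
  obtain ⟨C, hC, hF⟩ := FF_upper hr hrs hX hY ht0 (hup t ht1)
  have hF5 : ∀ k : ℕ, (FF r s X Y k : ℝ) ≤ C * ((r : ℝ) ^ k) ^ γ₅ := by
    intro k
    refine (hF k).trans ?_
    gcongr
    exact one_le_pow₀ hr1.le
  have hev1 := FF_lower hr hrs hX hY hXn hYn h4 hlow
  have hev2 : ∀ᶠ N : ℕ in Filter.atTop, s * C ≤ ((r : ℝ) ^ N) ^ (γ₅ - t) :=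
    ((tendsto_rpow_atTop (sub_pos.2 ht2)).comp
      (tendsto_pow_atTop_atTop_of_one_lt hr1)).eventually_ge_atTop _
  obtain ⟨N₁, hN₁⟩ := Filter.eventually_atTop.1 (hev1.and hev2)
  refine ⟨(s : ℝ)⁻¹, 9 * s ^ 2 * C, by positivity, by positivity, N₁, fun N hN => ?_⟩
  obtain ⟨hA, hB⟩ := hN₁ N hN
  have hpow : ∀ γ : ℝ, (r : ℝ) ^ ((N : ℝ) * γ) = ((r : ℝ) ^ N) ^ γ := by
    intro γ
    rw [Real.rpow_mul (by positivity), Real.rpow_natCast]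
  have hp : (0 : ℝ) < (r : ℝ) ^ N := by positivity
  have hbound : ∀ M, nprime r s N ≤ M → M ≤ nprime r s N + 1 →
      ((r : ℝ) ^ N) ^ γ₄ ≤ ((prodSet (approx r X N) (approx s Y M)).ncard : ℝ) ∧
      ((prodSet (approx r X N) (approx s Y M)).ncard : ℝ) ≤ ((r : ℝ) ^ N) ^ γ₅ := by
    intro M h1 h2
    rw [prodSet_ncard hr hs2 hX hY]
    constructor
    · refine hA.trans ?_
      have : FF r s X Y N ≤ (dig r X N).card * (dig s Y M).card :=
        Nat.mul_le_mul_left _ (dig_card_mono hs2 h1)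
      exact_mod_cast this
    · have h3 := FF_shift hr hrs (X := X) hY (k := N) (m := M) 1 (by omega)
      rw [pow_one] at h3
      calc (((dig r X N).card * (dig s Y M).card : ℕ) : ℝ) ≤ s * (FF r s X Y N : ℝ) := by
            exact_mod_cast h3
        _ ≤ s * (C * ((r : ℝ) ^ N) ^ t) := by gcongr; exact hF N
        _ = (s * C) * ((r : ℝ) ^ N) ^ t := by ring
        _ ≤ ((r : ℝ) ^ N) ^ (γ₅ - t) * ((r : ℝ) ^ N) ^ t := by gcongr
        _ = _ := by rw [← Real.rpow_add hp]; congr 1; ring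
  have h5 : 0 < γ₅ := ht0.trans ht2
  rw [hpow, hpow]
  have b1 := hbound _ le_rfl (by omega)
  have b2 := hbound _ (Nat.le_succ _) le_rfl
  exact ⟨rgc_main hr hrs hX hY h5 hC hF5 N _ le_rfl (by omega),
    rgc_main hr hrs hX hY h5 hC hF5 N _ (Nat.le_succ _) le_rfl, b1.1, b1.2, b2.1, b2.2⟩
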